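/- Let a < 0 < b and g ∈ C²([a,b]) with g > 0 on (a,b) and g(a) = g(b) = 0, and let E₀ = {(x,y,z) ∈ ℍ : x² + y² < g(z), z ∈ (a,b)}. If there exists σ ∈ (0,1) such that 1 − 2g(z)g''(z)/(16 + g'(z)²) > σ for all z ∈ [a,b], then E₀ satisfies condition (S2): there exist r₀ > 0 and σ' > 0 such that for all 0 < r < r₀, all p ∈ ∂E₀ and all v ∈ ℍ₀ with |v| = 1, max{U₀(p·rv), U₀(p·rv⁻¹)} ≥ 1 + σ'r², where U₀ is the Minkowski-type functional of E₀. In particular, if g'' ≤ 0 on [a,b], then E₀ satisfies (S2). -/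

import Mathlib

open Filter Topology

noncomputable section

abbrev Heis := ℝ × ℝ × ℝ

def hMul (p q : Heis) : Heis :=
  (p.1 + q.1, p.2.1 + q.2.1, p.2.2 + q.2.2 + (p.1 * q.2.1 - q.1 * p.2.1) / 2)

def horiz : Set Heis := {h : Heis | h.2.2 = 0}

def hPlane (p : Heis) : Set Heis := {q : Heis | ∃ h ∈ horiz, q = hMul p h}

def hSeg (p q : Heis) : Set Heis :=
  {w : Heis | ∃ l : ℝ, 0 ≤ l ∧ l ≤ 1 ∧ w = l • p + (1 - l) • q}

def HConvex (E : Set Heis) : Prop :=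
  ∀ p ∈ E, ∀ q ∈ E, q ∈ hPlane p → hSeg p q ⊆ E

def HQuasiconvexOn (f : Heis → ℝ) (Ω : Set Heis) : Prop :=
  ∀ p ∈ Ω, ∀ q ∈ Ω, q ∈ hPlane p → ∀ w ∈ hSeg p q, f w ≤ max (f p) (f q)

def X1 (f : Heis → ℝ) (p : Heis) : ℝ :=
  fderiv ℝ f p (1, 0, 0) - p.2.1 / 2 * fderiv ℝ f p (0, 0, 1)

def X2 (f : Heis → ℝ) (p : Heis) : ℝ :=
  fderiv ℝ f p (0, 1, 0) + p.1 / 2 * fderiv ℝ f p (0, 0, 1)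

def gradH (f : Heis → ℝ) (p : Heis) : ℝ × ℝ := (X1 f p, X2 f p)

def hessH (f : Heis → ℝ) (p : Heis) : ℝ × ℝ × ℝ :=
  (X1 (X1 f) p, (X1 (X2 f) p + X2 (X1 f) p) / 2, X2 (X2 f) p)

def L0H (ξ : ℝ × ℝ) (A : ℝ × ℝ × ℝ) : ℝ :=
  sInf {m : ℝ | ∃ η : ℝ × ℝ, η.1 ^ 2 + η.2 ^ 2 = 1 ∧ ξ.1 * η.1 + ξ.2 * η.2 = 0 ∧
    m = A.1 * η.1 ^ 2 + 2 * A.2.1 * η.1 * η.2 + A.2.2 * η.2 ^ 2}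

def Lop (f : Heis → ℝ) (p : Heis) : ℝ := L0H (gradH f p) (hessH f p)

def LbarOp (f : Heis → ℝ) (p : Heis) : ℝ := limsup (Lop f) (𝓝 p)

def LstarOp (f : Heis → ℝ) (p : Heis) : ℝ :=
  limsup (fun q : (ℝ × ℝ) × ℝ × ℝ × ℝ => L0H q.1 q.2) (𝓝 (gradH f p, hessH f p))

def StrictLocalMaxOnSet (g : Heis → ℝ) (Ω : Set Heis) (p : Heis) : Prop :=
  ∃ U ∈ 𝓝 p, ∀ q ∈ U ∩ Ω, q ≠ p → g q < g p

def UniformlyHQuasiconvexOn (f : Heis → ℝ) (Ω : Set Heis) (r₀ lam : ℝ) : Prop :=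
  ∀ r : ℝ, 0 < r → r < r₀ → ∀ p ∈ Ω, ∀ v ∈ horiz, v.1 ^ 2 + v.2.1 ^ 2 = 1 →
    hMul p (r • v) ∈ Ω → hMul p (-(r • v)) ∈ Ω →
    f p ≤ max (f (hMul p (r • v))) (f (hMul p (-(r • v)))) - lam * r ^ 2

def gaugeK (p : Heis) : ℝ := ((p.1 ^ 2 + p.2.1 ^ 2) ^ 2 + 16 * p.2.2 ^ 2) ^ ((1 : ℝ) / 4)


open scoped Classical

/-- Non-isotropic dilation `δ_λ(x,y,z) = (λx, λy, λ²z)`. -/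
def dilH (l : ℝ) (p : Heis) : Heis := (l * p.1, l * p.2.1, l ^ 2 * p.2.2)

/-- Condition (S1): `δ_μ(closure E) ⊆ E` for all `0 < μ < 1`. -/
def S1cond (E : Set Heis) : Prop :=
  ∀ μ : ℝ, 0 < μ → μ < 1 → ∀ p ∈ closure E, dilH μ p ∈ E

/-- Minkowski-type functional `U₀` of an open bounded set `E`. -/
def mink (E : Set Heis) (p : Heis) : ℝ :=
  if p = 0 then 0
  else sSup {m : ℝ | ∃ μ : ℝ, 0 < μ ∧ dilH μ p ∉ E ∧ m = 1 / μ ^ 2}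

/-- Condition (S2): a reinforced h-convexity of `E` via its Minkowski functional. -/
def S2cond (E : Set Heis) : Prop :=
  ∃ r₀ : ℝ, 0 < r₀ ∧ ∃ σ : ℝ, 0 < σ ∧ ∀ r : ℝ, 0 < r → r < r₀ →
    ∀ p ∈ frontier E, ∀ v ∈ horiz, v.1 ^ 2 + v.2.1 ^ 2 = 1 →
      1 + σ * r ^ 2 ≤ max (mink E (hMul p (r • v))) (mink E (hMul p (-(r • v))))

/-- A `C²` function on a compact interval extends to the line, with uniformly continuous and bounded
second derivative. -/
lemma exists_C2_extension {a b : ℝ} (hab : a < b) {g : ℝ → ℝ}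
    (hg : ContDiffOn ℝ 2 g (Set.Icc a b)) :
    ∃ G G' G'' : ℝ → ℝ, (∀ x, HasDerivAt G (G' x) x) ∧ (∀ x, HasDerivAt G' (G'' x) x) ∧
      UniformContinuous G'' ∧ (∃ K, 0 ≤ K ∧ ∀ x, |G'' x| ≤ K) ∧
      ∀ z ∈ Set.Icc a b, G z = g z ∧ G' z = derivWithin g (Set.Icc a b) z ∧
        G'' z = derivWithin (derivWithin g (Set.Icc a b)) (Set.Icc a b) z := by
  set I := Set.Icc a b with hI
  have huniq : UniqueDiffOn ℝ I := uniqueDiffOn_Icc hab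
  have hg1 : ContDiffOn ℝ 1 (derivWithin g I) I := hg.derivWithin huniq (by norm_num)
  have hg2 : ContinuousOn (derivWithin (derivWithin g I) I) I :=
    hg1.continuousOn_derivWithin huniq (by norm_num)
  set f := I.domRestrict (derivWithin (derivWithin g I) I) with hf
  have hfc : Continuous f := continuousOn_iff_continuous_domRestrict.mp hg2
  have hfu : UniformContinuous f := CompactSpace.uniformContinuous_of_continuous hfc
  set G'' : ℝ → ℝ := fun x => f (Set.projIcc a b hab.le x) with hG2
  have hG2u : UniformContinuous G'' :=
    hfu.comp (LipschitzWith.projIcc hab.le).uniformContinuous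
  have hG2I : ∀ z ∈ I, G'' z = derivWithin (derivWithin g I) I z := by
    intro z hz
    simp only [hG2, Set.projIcc_of_mem hab.le hz, hf, Set.domRestrict_apply]
  set G' : ℝ → ℝ := fun x => derivWithin g I a + ∫ t in a..x, G'' t with hG1
  have hG1d : ∀ x, HasDerivAt G' (G'' x) x := fun x =>
    (intervalIntegral.integral_hasDerivAt_right (hG2u.continuous.intervalIntegrable _ _)
      (hG2u.continuous.stronglyMeasurableAtFilter _ _) hG2u.continuous.continuousAt).const_add _
  have hG1c : Continuous G' := continuous_iff_continuousAt.2 fun x => (hG1d x).continuousAt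
  set G : ℝ → ℝ := fun x => g a + ∫ t in a..x, G' t with hG
  have hGd : ∀ x, HasDerivAt G (G' x) x := fun x =>
    (intervalIntegral.integral_hasDerivAt_right (hG1c.intervalIntegrable _ _)
      (hG1c.stronglyMeasurableAtFilter _ _) hG1c.continuousAt).const_add _
  have key : ∀ u w u' : ℝ → ℝ, (∀ x ∈ I, HasDerivWithinAt u (u' x) I x) →
      (∀ x ∈ I, HasDerivWithinAt w (u' x) I x) → u a = w a → ∀ x ∈ I, u x = w x := by
    intro u w u' hu hw h0 x hx
    have := (convex_Icc a b).norm_image_sub_le_of_norm_hasDerivWithin_le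
      (f := fun y => u y - w y) (f' := fun y => u' y - u' y) (C := 0) (x := a) (y := x)
      (fun y hy => (hu y hy).sub (hw y hy)) (by simp) (Set.left_mem_Icc.2 hab.le) hx
    simp only [zero_mul, norm_le_zero_iff, h0, sub_self, sub_zero] at this
    linarith
  have hG1I : ∀ z ∈ I, G' z = derivWithin g I z := by
    refine key _ _ G'' (fun x _ => (hG1d x).hasDerivWithinAt) (fun x hx => ?_) (by simp [hG1])
    rw [hG2I x hx]
    exact (hg1.differentiableOn (by norm_num) x hx).hasDerivWithinAt
  have hGI : ∀ z ∈ I, G z = g z := by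
    refine key _ _ G' (fun x _ => (hGd x).hasDerivWithinAt) (fun x hx => ?_) (by simp [hG])
    rw [hG1I x hx]
    exact (hg.differentiableOn (by norm_num) x hx).hasDerivWithinAt
  obtain ⟨K, hK⟩ := (isCompact_range hfc).isBounded.exists_norm_le
  refine ⟨G, G', G'', hGd, hG1d, hG2u, ⟨K, ?_, fun x => ?_⟩,
    fun z hz => ⟨hGI z hz, hG1I z hz, hG2I z hz⟩⟩
  · exact (norm_nonneg _).trans (hK _ ⟨Set.projIcc a b hab.le a, rfl⟩)
  · exact hK _ ⟨_, rfl⟩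

/-- Second order Taylor expansion, uniform in the base point. -/
lemma exists_uniform_taylor_two {G G' G'' : ℝ → ℝ} (hG : ∀ x, HasDerivAt G (G' x) x)
    (hG' : ∀ x, HasDerivAt G' (G'' x) x) (hu : UniformContinuous G'') {η : ℝ} (hη : 0 < η) :
    ∃ δ > 0, ∀ z h, |h| < δ →
      |G (z + h) - G z - G' z * h - G'' z * h ^ 2 / 2| ≤ η * h ^ 2 := by
  obtain ⟨δ, hδ, hd⟩ := Metric.uniformContinuous_iff.1 hu η hη
  refine ⟨δ, hδ, fun z h hh => ?_⟩
  have mem0 : ∀ ρ : ℝ, 0 ≤ ρ → (0 : ℝ) ∈ Metric.closedBall (0 : ℝ) ρ := fun ρ hρ => by simpa using hρ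
  have h1 : ∀ u, |u| ≤ |h| → |G' (z + u) - G' z - G'' z * u| ≤ η * |u| := by
    intro u hu
    have := (convex_closedBall (0 : ℝ) |h|).norm_image_sub_le_of_norm_hasDerivWithin_le
      (f := fun u => G' (z + u) - G' z - G'' z * u)
      (f' := fun u => G'' (z + u) - G'' z * 1) (C := η) (x := 0) (y := u)
      (fun y _ => ((((hG' (z + y)).comp_const_add z y).sub_const _).sub
        ((hasDerivAt_id y).const_mul _)).hasDerivWithinAt)
      (fun y hy => by
        have hy' : |y| ≤ |h| := by simpa using hy
        have := hd (a := z + y) (b := z) (by simpa [Real.dist_eq] using hy'.trans_lt hh)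
        simpa [Real.dist_eq] using this.le)
      (mem0 _ (abs_nonneg h)) (by simpa using hu)
    simpa using this
  have := (convex_closedBall (0 : ℝ) |h|).norm_image_sub_le_of_norm_hasDerivWithin_le
    (f := fun u => G (z + u) - G z - G' z * u - G'' z * u ^ 2 / 2)
    (f' := fun u => G' (z + u) - G' z * 1 - G'' z * ((2 : ℕ) * u ^ (2 - 1)) / 2)
    (C := η * |h|) (x := 0) (y := h)
    (fun y _ => (((((hG (z + y)).comp_const_add z y).sub_const _).sub
      ((hasDerivAt_id y).const_mul _)).sub
      (((hasDerivAt_pow 2 y).const_mul _).div_const 2)).hasDerivWithinAt)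
    (fun y hy => by
      have hy' : |y| ≤ |h| := by simpa using hy
      have h2 := (h1 y hy').trans (mul_le_mul_of_nonneg_left hy' hη.le)
      have h3 : G' (z + y) - G' z * 1 - G'' z * ((2 : ℕ) * y ^ (2 - 1)) / 2 =
          G' (z + y) - G' z - G'' z * y := by
        norm_num
        ring
      rwa [Real.norm_eq_abs, h3])
    (mem0 _ (abs_nonneg h)) (by simp)
  simp only [add_zero, sub_self, mul_zero, Real.norm_eq_abs] at this
  calc _ = _ := by congr 1; norm_num
    _ ≤ η * |h| * |h - 0| := this
    _ = η * h ^ 2 := by rw [sub_zero, mul_assoc, abs_mul_abs_self]; ring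

/-- Quadratic growth of the defining function `x² + y² - G z` along the half of a horizontal line
on which its first derivative is nonnegative; `s` and `t` are the radial and angular components
of the unit direction, scaled by the distance to the axis. -/
lemma exists_quadratic_growth {G G' G'' : ℝ → ℝ} {a b K σ : ℝ}
    (hG : ∀ x, HasDerivAt G (G' x) x)
    (hG' : ∀ x, HasDerivAt G' (G'' x) x) (hu : UniformContinuous G'') (hK0 : 0 ≤ K)
    (hK : ∀ x, |G'' x| ≤ K) (hσ : 0 < σ) (hσ1 : σ < 1)
    (hS : ∀ z ∈ Set.Icc a b, σ < 1 - 2 * G z * G'' z / (16 + G' z ^ 2)) :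
    ∃ r₀ > 0, ∀ r, 0 < r → r < r₀ → ∀ z ∈ Set.Icc a b, ∀ s t : ℝ, s ^ 2 + t ^ 2 = G z →
      0 ≤ 2 * s - G' z * t / 2 → σ / 2 * r ^ 2 ≤ G z + 2 * r * s + r ^ 2 - G (z + r * t / 2) := by
  have hGc : Continuous G := continuous_iff_continuousAt.2 fun x => (hG x).continuousAt
  obtain ⟨M₀, hM₀⟩ := isCompact_Icc.exists_bound_of_continuousOn (s := Set.Icc a b) hGc.continuousOn
  set M := max M₀ 1 with hM
  have hM1 : 1 ≤ M := le_max_right _ _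
  have hGM : ∀ z ∈ Set.Icc a b, G z ≤ M := fun z hz =>
    (le_abs_self _).trans ((hM₀ z hz).trans (le_max_left _ _))
  obtain ⟨δ, hδ, hT⟩ := exists_uniform_taylor_two hG hG' hu (η := σ / M) (by positivity)
  refine ⟨min (δ / M) (1 / (K * M + 1)), by positivity, fun r hr hr0 z hz s t hst he => ?_⟩
  have hr1 : r * M < δ := (lt_div_iff₀ (by positivity)).1 (hr0.trans_le (min_le_left _ _))
  have hr2 : r * (K * M + 1) < 1 := (lt_div_iff₀ (by positivity)).1 (hr0.trans_le (min_le_right _ _))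
  have ht2 : t ^ 2 ≤ M := by nlinarith [hGM z hz, sq_nonneg s]
  have htM : |t| ≤ M := by
    refine abs_le_of_sq_le_sq (by nlinarith) (by linarith)
  have hh : |r * t / 2| < δ := by
    rw [abs_div, abs_mul, abs_of_pos hr, abs_two]
    nlinarith [abs_nonneg t, mul_le_mul_of_nonneg_left htM hr.le]
  have hTz := (abs_le.1 (hT z _ hh)).2
  set e := 2 * s - G' z * t / 2 with hedef
  have hD : 0 < 16 + G' z ^ 2 := by positivity
  have hkey : G'' z * t ^ 2 / 8 ≤ 1 - σ + K * M * e := by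
    rcases le_total (G'' z) 0 with h0 | h0
    · have : G'' z * t ^ 2 ≤ 0 := mul_nonpos_of_nonpos_of_nonneg h0 (sq_nonneg t)
      have : 0 ≤ K * M * e := by positivity
      linarith
    · have hSz := hS z hz
      have h1 : 2 * G z * G'' z < (1 - σ) * (16 + G' z ^ 2) := by
        rw [← div_lt_iff₀ hD]; linarith
      have h2 : (16 + G' z ^ 2) * t ^ 2 = 16 * G z - 4 * e * (G' z * t) - 4 * e ^ 2 := by
        rw [← hst, hedef]; ring
      have h3 : -(G' z * t) ≤ (16 + G' z ^ 2) * M := by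
        have h4 : |G' z| ≤ 16 + G' z ^ 2 := by
          rw [← sq_abs]; nlinarith [sq_nonneg (|G' z| - 1)]
        calc -(G' z * t) ≤ |G' z * t| := neg_le_abs _
          _ = |G' z| * |t| := abs_mul _ _
          _ ≤ _ := by gcongr
      have h5 : G'' z * e * (-(G' z * t)) ≤ K * e * ((16 + G' z ^ 2) * M) := by
        have hK' := (le_abs_self _).trans (hK z)
        calc G'' z * e * (-(G' z * t)) ≤ G'' z * e * ((16 + G' z ^ 2) * M) := by gcongr
          _ ≤ _ := by gcongr
      have h6 : 0 ≤ K * e * ((16 + G' z ^ 2) * M) := by positivity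
      have h7 : 0 ≤ G'' z * e ^ 2 := by positivity
      refine le_of_mul_le_mul_left ?_ hD
      have h8 : (16 + G' z ^ 2) * (G'' z * t ^ 2 / 8) =
          2 * G z * G'' z + G'' z * e * (-(G' z * t)) / 2 - G'' z * e ^ 2 / 2 := by
        linear_combination G'' z / 8 * h2
      rw [h8]
      linarith
  have hη : σ / M * (r * t / 2) ^ 2 ≤ σ / 4 * r ^ 2 := by
    have : σ / M * (r * t / 2) ^ 2 = σ / 4 * r ^ 2 * (t ^ 2 / M) := by ring
    rw [this]
    exact mul_le_of_le_one_right (by positivity) ((div_le_one (by positivity)).2 ht2)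
  have h9 := mul_le_mul_of_nonneg_left hkey (sq_nonneg r)
  have h10 : r * (K * M) * (r * e) ≤ 1 * (r * e) := by
    gcongr
    linarith
  have h11 : r * e = 2 * r * s - G' z * (r * t / 2) := by rw [hedef]; ring
  have h12 : 0 ≤ σ / 4 * r ^ 2 := by positivity
  linarith

lemma le_mink_of_dilH_notMem {E : Set Heis} (hE : IsOpen E) (h0 : (0 : Heis) ∈ E) {q : Heis}
    (hq : q ≠ 0) {μ : ℝ} (hμ : 0 < μ) (h : dilH μ q ∉ E) : 1 / μ ^ 2 ≤ mink E q := by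
  rw [mink, if_neg hq]
  refine le_csSup ?_ ⟨μ, hμ, h, rfl⟩
  have hc : Continuous fun l : ℝ => dilH l q := by unfold dilH; fun_prop
  have hmem : (fun l : ℝ => dilH l q) ⁻¹' E ∈ 𝓝 (0 : ℝ) := by
    refine (hE.preimage hc).mem_nhds ?_
    have : dilH 0 q = 0 := by ext <;> simp [dilH]
    rwa [Set.mem_preimage, this]
  obtain ⟨ε, hε, hball⟩ := Metric.mem_nhds_iff.1 hmem
  refine ⟨1 / ε ^ 2, ?_⟩
  rintro m ⟨l, hl, hlE, rfl⟩
  have : ε ≤ l := by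
    by_contra! hlt
    exact hlE (hball (by simpa [abs_of_pos hl] using hlt))
  gcongr

/-- A positive lower bound on the defining function gives a lower bound on the functional. -/
lemma one_add_le_mink_of_le {G G' : ℝ → ℝ} {a b : ℝ} {R L ε : ℝ} {E : Set Heis} (hE : IsOpen E)
    (h0 : (0 : Heis) ∈ E)
    (hEG : E = {p : Heis | a < p.2.2 ∧ p.2.2 < b ∧ p.1 ^ 2 + p.2.1 ^ 2 < G p.2.2})
    (hG : ∀ x, HasDerivAt G (G' x) x) (hL : ∀ x ∈ Set.Icc (-R) R, |G' x| ≤ L) (hL0 : 0 ≤ L)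
    {q : Heis} (hqz : |q.2.2| ≤ R) (hqr : q.1 ^ 2 + q.2.1 ^ 2 ≤ R) (hε : 0 < ε)
    (hq : ε * (R + L * R) ≤ q.1 ^ 2 + q.2.1 ^ 2 - G q.2.2) : 1 + ε ≤ mink E q := by
  have hR : 0 ≤ R := (abs_nonneg _).trans hqz
  have hq0 : q ≠ 0 := by
    rintro rfl
    rw [hEG] at h0
    have h1 : 0 ≤ ε * (R + L * R) := by positivity
    have h2 := h0.2.2
    linarith
  set k := 1 / (1 + ε) with hk
  have hk0 : 0 < k := by positivity
  have hk1 : k ≤ 1 := (div_le_one (by positivity)).2 (by linarith)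
  have hkε : 1 - k ≤ ε := by
    have : k * (1 + ε) = 1 := by rw [hk]; field_simp
    nlinarith
  have hsq : √k ^ 2 = k := Real.sq_sqrt hk0.le
  have hmain : dilH √k q ∉ E := by
    rw [hEG]
    rintro ⟨-, -, h⟩
    simp only [dilH, mul_pow, hsq] at h
    have hkz : k * q.2.2 ∈ Set.Icc (-R) R := by
      rw [Set.mem_Icc, ← abs_le, abs_mul, abs_of_pos hk0]
      nlinarith [abs_nonneg q.2.2]
    have hlip := (convex_Icc (-R) R).norm_image_sub_le_of_norm_hasDerivWithin_le
      (f := G) (f' := G') (C := L) (fun x _ => (hG x).hasDerivWithinAt) hL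
      (abs_le.1 hqz) hkz
    have h1 : |k * q.2.2 - q.2.2| ≤ (1 - k) * R := by
      rw [show k * q.2.2 - q.2.2 = -((1 - k) * q.2.2) by ring, abs_neg, abs_mul,
        abs_of_nonneg (by linarith : 0 ≤ 1 - k)]
      exact mul_le_mul_of_nonneg_left hqz (by linarith)
    have h2 := (le_abs_self _).trans (hlip.trans (mul_le_mul_of_nonneg_left h1 hL0))
    have h3 : (1 - k) * (q.1 ^ 2 + q.2.1 ^ 2) ≤ (1 - k) * R :=
      mul_le_mul_of_nonneg_left hqr (by linarith)
    have h4 : (1 - k) * (R + L * R) ≤ ε * (R + L * R) :=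
      mul_le_mul_of_nonneg_right hkε (by positivity)
    linarith
  have := le_mink_of_dilH_notMem hE h0 hq0 (Real.sqrt_pos.2 hk0) hmain
  rwa [hsq, hk, one_div_one_div] at this

theorem S2cond_of_curvature_bound {a b : ℝ} (ha : a < 0) (hb : 0 < b)
    {g : ℝ → ℝ} (hg : ContDiffOn ℝ 2 g (Set.Icc a b))
    (hgpos : ∀ z ∈ Set.Ioo a b, 0 < g z) (hga : g a = 0) (hgb : g b = 0)
    {σ : ℝ} (hσ : 0 < σ) (hσ1 : σ < 1)
    (hS : ∀ z ∈ Set.Icc a b,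
        σ < 1 - 2 * g z * derivWithin (derivWithin g (Set.Icc a b)) (Set.Icc a b) z /
          (16 + (derivWithin g (Set.Icc a b) z) ^ 2)) :
    S2cond {p : Heis | a < p.2.2 ∧ p.2.2 < b ∧ p.1 ^ 2 + p.2.1 ^ 2 < g p.2.2} := by
  obtain ⟨G, G', G'', hG, hG', hu, ⟨K, hK0, hK⟩, hext⟩ := exists_C2_extension (ha.trans hb) hg
  set E := {p : Heis | a < p.2.2 ∧ p.2.2 < b ∧ p.1 ^ 2 + p.2.1 ^ 2 < g p.2.2} with hEdef
  have hEG : E = {p : Heis | a < p.2.2 ∧ p.2.2 < b ∧ p.1 ^ 2 + p.2.1 ^ 2 < G p.2.2} := by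
    ext p
    simp only [hEdef, Set.mem_ofPred_eq]
    refine and_congr_right fun h1 => and_congr_right fun h2 => ?_
    rw [(hext _ ⟨h1.le, h2.le⟩).1]
  have hGc : Continuous G := continuous_iff_continuousAt.2 fun x => (hG x).continuousAt
  have hG'c : Continuous G' := continuous_iff_continuousAt.2 fun x => (hG' x).continuousAt
  have hE : IsOpen E := by
    rw [hEG]
    refine IsOpen.and ?_ (IsOpen.and ?_ ?_) <;> exact isOpen_lt (by fun_prop) (by fun_prop)
  have h0 : (0 : Heis) ∈ E := by
    refine ⟨ha, hb, ?_⟩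
    simpa using hgpos 0 ⟨ha, hb⟩
  have hfr : ∀ p ∈ frontier E, p.2.2 ∈ Set.Icc a b ∧ p.1 ^ 2 + p.2.1 ^ 2 = G p.2.2 := by
    intro p hp
    have hcl : closure E ⊆ {p : Heis | a ≤ p.2.2 ∧ p.2.2 ≤ b ∧ p.1 ^ 2 + p.2.1 ^ 2 ≤ G p.2.2} := by
      refine closure_minimal ?_ ?_
      · rw [hEG]
        exact fun p hp => ⟨hp.1.le, hp.2.1.le, hp.2.2.le⟩
      · refine IsClosed.and ?_ (IsClosed.and ?_ ?_) <;>
          exact isClosed_le (by fun_prop) (by fun_prop)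
    obtain ⟨h1, h2, h3⟩ := hcl hp.1
    have hz : p.2.2 ∈ Set.Icc a b := ⟨h1, h2⟩
    refine ⟨hz, h3.antisymm (not_lt.1 fun hlt => ?_)⟩
    have hpos : 0 < g p.2.2 := by
      rw [← (hext _ hz).1]
      exact lt_of_le_of_lt (by positivity) hlt
    have hpE : p ∈ E := by
      rw [hEG]
      refine ⟨lt_of_le_of_ne h1 ?_, lt_of_le_of_ne h2 ?_, hlt⟩
      · intro h
        rw [← h, hga] at hpos
        exact hpos.false
      · intro h
        rw [h, hgb] at hpos
        exact hpos.false
    exact hp.2 (hE.interior_eq.symm ▸ hpE)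
  obtain ⟨r₁, hr₁, hgrow⟩ := exists_quadratic_growth (a := a) (b := b) hG hG' hu hK0 hK hσ hσ1
    fun z hz => by
      rw [(hext z hz).1, (hext z hz).2.1, (hext z hz).2.2]
      exact hS z hz
  obtain ⟨M₀, hM₀⟩ := isCompact_Icc.exists_bound_of_continuousOn (s := Set.Icc a b) hGc.continuousOn
  set M := max M₀ 1 with hM
  have hM1 : 1 ≤ M := le_max_right _ _
  have hGM : ∀ z ∈ Set.Icc a b, G z ≤ M := fun z hz =>
    (le_abs_self _).trans ((hM₀ z hz).trans (le_max_left _ _))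
  have hMM : M ≤ M ^ 2 := le_self_pow₀ hM1 two_ne_zero
  set R := 4 * M + b - a with hR
  obtain ⟨L₀, hL₀⟩ := isCompact_Icc.exists_bound_of_continuousOn (s := Set.Icc (-R) R)
    hG'c.continuousOn
  set L := max L₀ 0 with hL
  have hL0 : 0 ≤ L := le_max_right _ _
  have hGL : ∀ z ∈ Set.Icc (-R) R, |G' z| ≤ L := fun z hz => (hL₀ z hz).trans (le_max_left _ _)
  have hRpos : 0 < R := by linarith
  have hden : 0 < R + L * R := by positivity
  refine ⟨min r₁ 1, by positivity, σ / 2 / (R + L * R), by positivity,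
    fun r hr hr0 p hp v hv hv1 => ?_⟩
  have hrr₁ : r < r₁ := hr0.trans_le (min_le_left _ _)
  have hr1 : r < 1 := hr0.trans_le (min_le_right _ _)
  obtain ⟨hz, hpG⟩ := hfr p hp
  have hv2 : v.2.2 = 0 := hv
  have hside : ∀ w : Heis, w.2.2 = 0 → w.1 ^ 2 + w.2.1 ^ 2 = 1 →
      0 ≤ 2 * (p.1 * w.1 + p.2.1 * w.2.1) - G' p.2.2 * (p.1 * w.2.1 - p.2.1 * w.1) / 2 →
      1 + σ / 2 / (R + L * R) * r ^ 2 ≤ mink E (hMul p (r • w)) := by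
    intro w hw hw1 he
    set s := p.1 * w.1 + p.2.1 * w.2.1 with hs
    set t := p.1 * w.2.1 - p.2.1 * w.1 with ht
    have hst : s ^ 2 + t ^ 2 = G p.2.2 := by
      rw [← hpG, hs, ht]
      linear_combination (p.1 ^ 2 + p.2.1 ^ 2) * hw1
    have hsM : |s| ≤ M := abs_le_of_sq_le_sq (by linarith [hGM _ hz, sq_nonneg t]) (by linarith)
    have htM : |t| ≤ M := abs_le_of_sq_le_sq (by linarith [hGM _ hz, sq_nonneg s]) (by linarith)
    have hq1 : (hMul p (r • w)).1 ^ 2 + (hMul p (r • w)).2.1 ^ 2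
        = G p.2.2 + 2 * r * s + r ^ 2 := by
      simp only [hMul, Prod.smul_fst, Prod.smul_snd, smul_eq_mul]
      rw [← hpG, hs]
      linear_combination r ^ 2 * hw1
    have hq2 : (hMul p (r • w)).2.2 = p.2.2 + r * t / 2 := by
      simp only [hMul, Prod.smul_fst, Prod.smul_snd, smul_eq_mul, hw, ht]
      ring
    have hrs : r * |s| ≤ 1 * M := by gcongr
    have hrt : r * |t| ≤ 1 * M := by gcongr
    have hrs' : r * s ≤ r * |s| := mul_le_mul_of_nonneg_left (le_abs_self s) hr.le
    have hrt' : r * t ≤ r * |t| := mul_le_mul_of_nonneg_left (le_abs_self t) hr.le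
    have hrt'' : r * -t ≤ r * |t| := mul_le_mul_of_nonneg_left (neg_le_abs t) hr.le
    refine one_add_le_mink_of_le hE h0 hEG hG hGL hL0 ?_ ?_ (by positivity) ?_
    · rw [hq2, abs_le]
      constructor <;> linarith [hz.1, hz.2]
    · rw [hq1]
      have : r ^ 2 ≤ 1 := pow_le_one₀ hr.le hr1.le
      linarith [hGM _ hz]
    · rw [hq1, hq2]
      have h1 := hgrow r hr hrr₁ _ hz s t hst he
      have h2 : σ / 2 / (R + L * R) * r ^ 2 * (R + L * R) = σ / 2 * r ^ 2 := by
        rw [mul_right_comm, div_mul_cancel₀ _ hden.ne']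
      exact h2.trans_le h1
  rcases le_total 0 (2 * (p.1 * v.1 + p.2.1 * v.2.1) -
      G' p.2.2 * (p.1 * v.2.1 - p.2.1 * v.1) / 2) with h | h
  · exact le_max_of_le_left (hside v hv2 hv1 h)
  · refine le_max_of_le_right ?_
    rw [← smul_neg]
    refine hside (-v) (by simp [hv2]) (by simpa using hv1) ?_
    simp only [Prod.fst_neg, Prod.snd_neg]
    linarith

theorem statement19 (a b : ℝ) (ha : a < 0) (hb : 0 < b)
    (g : ℝ → ℝ) (hg : ContDiffOn ℝ 2 g (Set.Icc a b))
    (hgpos : ∀ z ∈ Set.Ioo a b, 0 < g z) (hga : g a = 0) (hgb : g b = 0)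
    (E₀ : Set Heis)
    (hE₀ : E₀ = {p : Heis | a < p.2.2 ∧ p.2.2 < b ∧ p.1 ^ 2 + p.2.1 ^ 2 < g p.2.2}) :
    ((∃ σ : ℝ, 0 < σ ∧ σ < 1 ∧ ∀ z ∈ Set.Icc a b,
        σ < 1 - 2 * g z * derivWithin (derivWithin g (Set.Icc a b)) (Set.Icc a b) z /
          (16 + (derivWithin g (Set.Icc a b) z) ^ 2)) → S2cond E₀) ∧
    ((∀ z ∈ Set.Icc a b,
        derivWithin (derivWithin g (Set.Icc a b)) (Set.Icc a b) z ≤ 0) → S2cond E₀) := by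
  subst hE₀
  refine ⟨fun ⟨σ, hσ, hσ1, hS⟩ => S2cond_of_curvature_bound ha hb hg hgpos hga hgb hσ hσ1 hS,
    fun h => S2cond_of_curvature_bound ha hb hg hgpos hga hgb (σ := 1 / 2) (by norm_num)
      (by norm_num) fun z hz => ?_⟩
  have hgz : 0 ≤ g z := by
    rcases eq_or_lt_of_le hz.1 with h1 | h1
    · rw [← h1, hga]
    rcases eq_or_lt_of_le hz.2 with h2 | h2
    · rw [h2, hgb]
    exact (hgpos z ⟨h1, h2⟩).le
  have : 2 * g z * derivWithin (derivWithin g (Set.Icc a b)) (Set.Icc a b) z /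
      (16 + (derivWithin g (Set.Icc a b) z) ^ 2) ≤ 0 :=
    div_nonpos_of_nonpos_of_nonneg
      (mul_nonpos_of_nonneg_of_nonpos (by positivity) (h z hz)) (by positivity)
  linarith
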